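/- For an r×r matrix B of commuting formal variables, 1/det(I-B) equals the product over all nonperiodic cycles c in the complete digraph K_r of 1/(1 - β(c)), where β(c) is the product of the edge weights along c. -/

import Mathlib

/-- A word is Lyndon if it is nonempty and strictly lexicographically smaller than
all of its nontrivial cyclic rotations.  Nonperiodic cycles of the complete digraph
`K_r` correspond bijectively to Lyndon words over `{1,…,r}`, each cycle being
represented by its lexicographically least pointed representative. -/
def IsLyndon {α : Type*} [LinearOrder α] (w : List α) : Prop :=
  w ≠ [] ∧ ∀ k, 0 < k → k < w.length → List.Lex (· < ·) w (w.rotate k)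

/-- The weight `β(c)` of a cycle represented by the word `w = x₁…x_m`:
the product of the edge variables `b_{x₁x₂} b_{x₂x₃} ⋯ b_{x_m x₁}`. -/
noncomputable def cycleWeight {r : ℕ} (w : List (Fin r)) :
    MvPowerSeries (Fin r × Fin r) ℚ :=
  ((w.zip (w.rotate 1)).map fun e => MvPowerSeries.X e).prod

noncomputable instance {σ : Type*} : TopologicalSpace (MvPowerSeries σ ℚ) :=
  @Pi.topologicalSpace (σ →₀ ℕ) (fun _ => ℚ) (fun _ => ⊥)

open MvPowerSeries

theorem Derivation.map_finset_prod {R A ι : Type*} [CommRing R] [CommRing A] [Algebra R A]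
    [DecidableEq ι] (D : Derivation R A A) (s : Finset ι) (f : ι → A) :
    D (∏ i ∈ s, f i) = ∑ k ∈ s, ∏ i ∈ s, Function.update f k (D (f k)) i := by
  induction s using Finset.induction_on with
  | empty => simp
  | insert a s ha ih =>
    rw [Finset.prod_insert ha, D.leibniz, ih, Finset.sum_insert ha, Finset.prod_insert ha,
      Function.update_self, smul_eq_mul, smul_eq_mul, add_comm, mul_comm, Finset.mul_sum]
    congr 1
    · congr 1
      refine Finset.prod_congr rfl fun i hi => ?_
      rw [Function.update_of_ne (ne_of_mem_of_not_mem hi ha)]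
    · refine Finset.sum_congr rfl fun k hk => ?_
      rw [Finset.prod_insert ha, Function.update_of_ne (ne_of_mem_of_not_mem hk ha).symm]

theorem Derivation.map_prod_of_eq_mul {R A ι : Type*} [CommRing R] [CommRing A] [Algebra R A]
    (D : Derivation R A A) (s : Finset ι) {f g : ι → A} (h : ∀ i ∈ s, D (f i) = f i * g i) :
    D (∏ i ∈ s, f i) = (∏ i ∈ s, f i) * ∑ i ∈ s, g i := by
  classical
  rw [D.map_finset_prod, Finset.mul_sum]
  refine Finset.sum_congr rfl fun k hk => ?_
  rw [Finset.prod_update_of_mem hk, h k hk, ← Finset.mul_prod_erase s f hk,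
    Finset.sdiff_singleton_eq_erase]
  ring

/-- Jacobi's formula for the derivative of a determinant. -/
theorem Derivation.map_det {R A n : Type*} [CommRing R] [CommRing A] [Algebra R A]
    [Fintype n] [DecidableEq n] (D : Derivation R A A) (M : Matrix n n A) :
    D M.det = (M.adjugate * M.map D).trace := by
  have hcol (k : n) : (M.adjugate * M.map D) k k = (M.updateCol k fun i => D (M i k)).det := by
    rw [← Matrix.cramer_apply, Matrix.cramer_eq_adjugate_mulVec]
    rfl
  simp only [Matrix.trace, Matrix.diag_apply, hcol, Matrix.det_apply, map_sum, Units.smul_def,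
    map_zsmul, D.map_finset_prod, Finset.smul_sum]
  rw [Finset.sum_comm]
  refine Finset.sum_congr rfl fun k _ => Finset.sum_congr rfl fun σ _ => ?_
  congr 1
  refine Finset.prod_congr rfl fun i _ => ?_
  by_cases h : i = k
  · subst h; simp
  · simp [h]

namespace MvPowerSeries

variable {σ : Type*}

/-- The Euler derivation, which multiplies each monomial by its degree. -/
noncomputable def euler : Derivation ℚ (MvPowerSeries σ ℚ) (MvPowerSeries σ ℚ) :=
  Derivation.mk'
    { toFun := fun f d => (d.degree : ℚ) * coeff d f
      map_add' := fun f g => funext fun d => mul_add _ (coeff d f) (coeff d g)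
      map_smul' := fun c f => funext fun d => mul_left_comm _ c (coeff d f) }
    fun f g => by
      classical
      ext d
      change (d.degree : ℚ) * coeff d (f * g) = _
      rw [smul_eq_mul, smul_eq_mul, mul_comm g, map_add, coeff_mul, coeff_mul, coeff_mul,
        Finset.mul_sum, ← Finset.sum_add_distrib]
      refine Finset.sum_congr rfl fun p hp => ?_
      rw [← Finset.HasAntidiagonal.mem_antidiagonal.mp hp, map_add]
      change _ = coeff p.1 f * (p.2.degree * coeff p.2 g) + p.1.degree * coeff p.1 f * coeff p.2 g
      push_cast
      ring

theorem coeff_euler (d : σ →₀ ℕ) (f : MvPowerSeries σ ℚ) :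
    coeff d (euler f) = d.degree * coeff d f := rfl

/-- All monomials occurring in `f` have degree `n`. -/
def IsPure (f : MvPowerSeries σ ℚ) (n : ℕ) : Prop :=
  ∀ d : σ →₀ ℕ, d.degree ≠ n → coeff d f = 0

theorem IsPure.coeff_eq_zero {f : MvPowerSeries σ ℚ} {n : ℕ} (hf : f.IsPure n) {d : σ →₀ ℕ}
    (hd : d.degree ≠ n) : coeff d f = 0 :=
  hf d hd

theorem IsPure.add {f g : MvPowerSeries σ ℚ} {n : ℕ} (hf : f.IsPure n) (hg : g.IsPure n) :
    (f + g).IsPure n := fun d hd => by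
  rw [map_add, hf d hd, hg d hd, add_zero]

theorem IsPure.mul {f g : MvPowerSeries σ ℚ} {m n : ℕ} (hf : f.IsPure m) (hg : g.IsPure n) :
    (f * g).IsPure (m + n) := fun d hd => by
  classical
  rw [coeff_mul]
  refine Finset.sum_eq_zero fun p hp => ?_
  by_cases hm : p.1.degree = m
  · rw [hg p.2, mul_zero]
    rintro rfl
    rw [← Finset.HasAntidiagonal.mem_antidiagonal.mp hp, map_add, hm] at hd
    exact hd rfl
  · rw [hf p.1 hm, zero_mul]

theorem euler_eq_of_isPure {f : MvPowerSeries σ ℚ} {n : ℕ} (hf : f.IsPure n) :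
    euler f = n * f := by
  ext d
  rw [coeff_euler, ← nsmul_eq_mul n f, map_nsmul, nsmul_eq_mul]
  by_cases h : d.degree = n
  · rw [h]
  · rw [hf.coeff_eq_zero h, mul_zero, mul_zero]

theorem isPure_X (s : σ) : (X s : MvPowerSeries σ ℚ).IsPure 1 := by
  classical
  intro d hd
  rw [coeff_X, if_neg]
  rintro rfl
  simp at hd

theorem isPure_one : (1 : MvPowerSeries σ ℚ).IsPure 0 := by
  classical
  intro d hd
  rw [coeff_one, if_neg]
  rintro rfl
  simp at hd

theorem isPure_zero (n : ℕ) : (0 : MvPowerSeries σ ℚ).IsPure n :=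
  fun _ _ => map_zero _

theorem isPure_sum {ι : Type*} {n : ℕ} {s : Finset ι} {f : ι → MvPowerSeries σ ℚ}
    (h : ∀ i ∈ s, (f i).IsPure n) : (∑ i ∈ s, f i).IsPure n :=
  Finset.sum_induction f (·.IsPure n) (fun _ _ => IsPure.add) (isPure_zero n) h

theorem isPure_list_prod_map {ι : Type*} (l : List ι) {f : ι → MvPowerSeries σ ℚ}
    (h : ∀ i, (f i).IsPure 1) : (l.map f).prod.IsPure l.length := by
  induction l with
  | nil => simpa using isPure_one
  | cons a l ih => rw [List.map_cons, List.prod_cons, List.length_cons, add_comm]; exact (h a).mul ih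

theorem isPure_matrix_pow {n : Type*} [Fintype n] [DecidableEq n]
    {M : Matrix n n (MvPowerSeries σ ℚ)} {k : ℕ} (hM : ∀ i j, (M i j).IsPure k)
    (m : ℕ) (i j : n) : ((M ^ m) i j).IsPure (m * k) := by
  induction m generalizing i with
  | zero =>
    rw [pow_zero, zero_mul, Matrix.one_apply]
    split_ifs
    exacts [isPure_one, isPure_zero 0]
  | succ m ih =>
    rw [pow_succ', Matrix.mul_apply, add_mul, one_mul, add_comm]
    exact isPure_sum fun l _ => (hM i l).mul (ih l)

/-- The geometric series of a matrix with homogeneous entries, coefficientwise. -/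
theorem coeff_right_inverse_one_sub {n : Type*} [Fintype n] [DecidableEq n]
    {M N : Matrix n n (MvPowerSeries σ ℚ)} {k : ℕ} (hk : 0 < k)
    (hM : ∀ i j, (M i j).IsPure k) (hN : (1 - M) * N = 1) (d : σ →₀ ℕ) (i j : n) :
    coeff d (N i j) = if k ∣ d.degree then coeff d ((M ^ (d.degree / k)) i j) else 0 := by
  have hgeom (m : ℕ) : N = ∑ l ∈ Finset.range m, M ^ l + M ^ m * N := by
    have h := geom_sum_mul_neg M m
    calc N = ((∑ l ∈ Finset.range m, M ^ l) * (1 - M) + M ^ m) * N := by rw [h]; simp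
      _ = _ := by rw [add_mul, mul_assoc, hN, mul_one]
  rw [hgeom (d.degree / k + 1), Matrix.add_apply, Matrix.sum_apply, map_add, map_sum]
  have htail : coeff d ((M ^ (d.degree / k + 1) * N) i j) = 0 := by
    classical
    rw [Matrix.mul_apply, map_sum]
    refine Finset.sum_eq_zero fun l _ => ?_
    rw [coeff_mul]
    refine Finset.sum_eq_zero fun p hp => ?_
    have hlt : d.degree < (d.degree / k + 1) * k := by
      rw [mul_comm]; exact Nat.lt_mul_div_succ _ hk
    have hle : p.1.degree ≤ d.degree := by
      rw [← Finset.HasAntidiagonal.mem_antidiagonal.mp hp, map_add]; exact Nat.le_add_right _ _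
    rw [(isPure_matrix_pow hM _ i l).coeff_eq_zero (hle.trans_lt hlt).ne, zero_mul]
  rw [htail, add_zero]
  split_ifs with hdvd
  · refine Finset.sum_eq_single_of_mem _ (by simp) fun l _ hl => ?_
    refine (isPure_matrix_pow hM l i j).coeff_eq_zero fun h => hl ?_
    rw [h, Nat.mul_div_cancel _ hk]
  · refine Finset.sum_eq_zero fun l _ => ?_
    exact (isPure_matrix_pow hM l i j).coeff_eq_zero fun h => hdvd ⟨l, by rw [h, mul_comm]⟩

theorem coeff_inv_one_sub {f : MvPowerSeries σ ℚ} {k : ℕ} (hk : 0 < k) (hf : f.IsPure k)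
    (d : σ →₀ ℕ) :
    coeff d (1 - f)⁻¹ = if k ∣ d.degree then coeff d (f ^ (d.degree / k)) else 0 := by
  have hf0 : constantCoeff f = 0 := by
    rw [← coeff_zero_eq_constantCoeff_apply]
    exact hf.coeff_eq_zero (by simpa using hk.ne)
  have h := coeff_right_inverse_one_sub (M := Matrix.diagonal fun _ : Unit => f)
    (N := Matrix.diagonal fun _ => (1 - f)⁻¹) hk (by simpa using hf)
    (by rw [← Matrix.diagonal_one, Matrix.diagonal_sub, Matrix.diagonal_mul_diagonal]
        congr 1
        funext _
        exact MvPowerSeries.mul_inv_cancel _ (by simp [hf0])) d () ()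
  simpa [Matrix.diagonal_pow] using h

/-- A series whose logarithmic Euler derivative vanishes up to degree `n`, and with constant
coefficient `1`, agrees with `1` up to degree `n`. -/
theorem coeff_eq_coeff_one_of_euler_eq {H L : MvPowerSeries σ ℚ} {n : ℕ} (h : euler H = H * L)
    (hL : ∀ d : σ →₀ ℕ, d.degree ≤ n → coeff d L = 0) (h0 : constantCoeff H = 1)
    {d : σ →₀ ℕ} (hd : d.degree ≤ n) : coeff d H = coeff d 1 := by
  classical
  by_cases hd0 : d = 0
  · subst hd0; simpa using h0
  · have h1 := congrArg (coeff d) h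
    rw [coeff_euler, coeff_mul, Finset.sum_eq_zero] at h1
    · rw [coeff_one, if_neg hd0]
      refine (mul_eq_zero.mp h1).resolve_left ?_
      simpa [Finsupp.degree_eq_zero_iff] using hd0
    · intro p hp
      rw [hL p.2, mul_zero]
      refine le_trans ?_ hd
      rw [← Finset.HasAntidiagonal.mem_antidiagonal.mp hp, map_add]
      exact Nat.le_add_left _ _

theorem coeff_mul_eq_of_coeff_eq_one {H G : MvPowerSeries σ ℚ} {n : ℕ}
    (hH : ∀ d : σ →₀ ℕ, d.degree ≤ n → coeff d H = coeff d 1)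
    {d : σ →₀ ℕ} (hd : d.degree ≤ n) : coeff d (H * G) = coeff d G := by
  classical
  nth_rw 2 [← one_mul G]
  rw [coeff_mul, coeff_mul]
  refine Finset.sum_congr rfl fun p hp => ?_
  rw [hH p.1 (le_trans ?_ hd)]
  rw [← Finset.HasAntidiagonal.mem_antidiagonal.mp hp, map_add]
  exact Nat.le_add_right _ _

end MvPowerSeries

section PeriodicWords

open Function

variable {α : Type*}

/-- The shift operator on infinite sequences. -/
def seqShift (f : ℕ → α) : ℕ → α := fun i => f (i + 1)

theorem seqShift_iterate_apply (f : ℕ → α) (k i : ℕ) : seqShift^[k] f i = f (i + k) := by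
  induction k generalizing f with
  | zero => rfl
  | succ k ih => rw [iterate_succ_apply, ih]; rfl

/-- The periodic sequence obtained by repeating a nonempty word. -/
def List.cyclicSeq (c : List α) (hc : c ≠ []) : ℕ → α :=
  fun i => c.get ⟨i % c.length, Nat.mod_lt _ (List.length_pos_iff.mpr hc)⟩

theorem List.isPeriodicPt_cyclicSeq (c : List α) (hc : c ≠ []) :
    IsPeriodicPt seqShift c.length (c.cyclicSeq hc) := by
  funext i
  simp [seqShift_iterate_apply, List.cyclicSeq]

theorem List.ofFn_seqShift_cyclicSeq (c : List α) (hc : c ≠ []) (k : ℕ) :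
    List.ofFn (fun i : Fin c.length => seqShift^[k] (c.cyclicSeq hc) i) = c.rotate k := by
  refine List.ext_getElem (by simp) fun i h₁ h₂ => ?_
  simp [List.getElem_rotate, seqShift_iterate_apply, List.cyclicSeq]

theorem eq_of_isPeriodicPt_seqShift {f g : ℕ → α} {n : ℕ} (hn : 0 < n)
    (hf : IsPeriodicPt seqShift n f) (hg : IsPeriodicPt seqShift n g)
    (h : ∀ i < n, f i = g i) : f = g := by
  have key {f : ℕ → α} (hf : IsPeriodicPt seqShift n f) (i : ℕ) : f i = f (i % n) := by
    have := congrFun (hf.iterate_mod_apply i) 0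
    simpa [seqShift_iterate_apply] using this.symm
  funext i
  rw [key hf, key hg, h _ (Nat.mod_lt _ hn)]

theorem cyclicSeq_ofFn {f : ℕ → α} {n : ℕ} (hn : 0 < n) (hf : IsPeriodicPt seqShift n f)
    (hc : List.ofFn (fun i : Fin n => f i) ≠ []) :
    (List.ofFn fun i : Fin n => f i).cyclicSeq hc = f := by
  refine eq_of_isPeriodicPt_seqShift hn ?_ hf fun i hi => ?_
  · simpa using List.isPeriodicPt_cyclicSeq _ hc
  · simp [List.cyclicSeq, Nat.mod_eq_of_lt hi]

variable [LinearOrder α]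

theorem IsLyndon.minimalPeriod_cyclicSeq {c : List α} (hc : IsLyndon c) :
    minimalPeriod seqShift (c.cyclicSeq hc.1) = c.length := by
  have hper := c.isPeriodicPt_cyclicSeq hc.1
  have hpos := List.length_pos_iff.mpr hc.1
  refine (hper.minimalPeriod_le hpos).eq_of_not_lt fun hlt => ?_
  have hlex := hc.2 _ (hper.minimalPeriod_pos hpos) hlt
  rw [← c.ofFn_seqShift_cyclicSeq hc.1, iterate_minimalPeriod] at hlex
  have h0 := c.ofFn_seqShift_cyclicSeq hc.1 0
  rw [iterate_zero_apply, List.rotate_zero] at h0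
  rw [h0] at hlex
  exact lt_irrefl c hlex

theorem IsLyndon.le_rotate {c : List α} (hc : IsLyndon c) {k : ℕ} (hk : k < c.length) :
    c ≤ c.rotate k := by
  rcases Nat.eq_zero_or_pos k with rfl | hk0
  · simp
  · exact le_of_lt (hc.2 k hk0 hk)

theorem IsLyndon.le_of_seqShift_eq {c c' : List α} (hc : IsLyndon c) (hc' : IsLyndon c')
    (hlen : c.length = c'.length) {k k' : ℕ} (hk' : k' < c'.length)
    (h : seqShift^[k] (c.cyclicSeq hc.1) = seqShift^[k'] (c'.cyclicSeq hc'.1)) : c ≤ c' := by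
  have hpos := List.length_pos_iff.mpr hc.1
  have hseq : seqShift^[(c.length - k' + k) % c.length] (c.cyclicSeq hc.1) =
      c'.cyclicSeq hc'.1 := by
    rw [(c.isPeriodicPt_cyclicSeq hc.1).iterate_mod_apply, iterate_add_apply, h,
      ← iterate_add_apply, hlen, Nat.sub_add_cancel hk'.le]
    exact c'.isPeriodicPt_cyclicSeq hc'.1
  have hrot : c.rotate ((c.length - k' + k) % c.length) = c' := by
    rw [← c.ofFn_seqShift_cyclicSeq hc.1, hseq, List.ofFn_congr hlen]
    simpa using c'.ofFn_seqShift_cyclicSeq hc'.1 0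
  exact (hc.le_rotate (Nat.mod_lt _ hpos)).trans_eq hrot

theorem IsLyndon.eq_of_seqShift_eq {c c' : List α} (hc : IsLyndon c) (hc' : IsLyndon c')
    {k k' : ℕ} (hk : k < c.length) (hk' : k' < c'.length)
    (h : seqShift^[k] (c.cyclicSeq hc.1) = seqShift^[k'] (c'.cyclicSeq hc'.1)) :
    c = c' ∧ k = k' := by
  have hmem {c : List α} (hc : IsLyndon c) : c.cyclicSeq hc.1 ∈ periodicPts seqShift :=
    mk_mem_periodicPts (List.length_pos_iff.mpr hc.1) (c.isPeriodicPt_cyclicSeq hc.1)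
  have hlen : c.length = c'.length := by
    rw [← hc.minimalPeriod_cyclicSeq, ← hc'.minimalPeriod_cyclicSeq,
      ← minimalPeriod_apply_iterate (hmem hc) k, h, minimalPeriod_apply_iterate (hmem hc') k']
  obtain rfl : c = c' := le_antisymm (hc.le_of_seqShift_eq hc' hlen hk' h)
    (hc'.le_of_seqShift_eq hc hlen.symm hk h.symm)
  rw [← hc.minimalPeriod_cyclicSeq] at hk hk'
  exact ⟨rfl, (iterate_eq_iterate_iff_of_lt_minimalPeriod hk hk').mp h⟩

theorem exists_isLyndon_seqShift_eq {f : ℕ → α} {n : ℕ} (hn : 0 < n)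
    (hf : IsPeriodicPt seqShift n f) :
    ∃ (c : List α) (hc : IsLyndon c) (k : ℕ), c.length ∣ n ∧ k < c.length ∧
      seqShift^[k] (c.cyclicSeq hc.1) = f := by
  set p := minimalPeriod seqShift f with hp
  have hppos : 0 < p := hf.minimalPeriod_pos hn
  have hper : IsPeriodicPt seqShift p f := isPeriodicPt_minimalPeriod _ _
  obtain ⟨k, hk, hmin⟩ := Finset.exists_min_image (Finset.range p)
    (fun k => List.ofFn fun i : Fin p => seqShift^[k] f i) ⟨0, Finset.mem_range.mpr hppos⟩
  rw [Finset.mem_range] at hk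
  set g := seqShift^[k] f with hg
  have hgper : IsPeriodicPt seqShift p g := hper.apply_iterate k
  have hne : List.ofFn (fun i : Fin p => g i) ≠ [] := by
    simpa [List.ofFn_eq_nil_iff] using hppos.ne'
  have hcyc := cyclicSeq_ofFn hppos hgper hne
  have hrot (j : ℕ) : (List.ofFn fun i : Fin p => g i).rotate j =
      List.ofFn fun i : Fin p => seqShift^[j] g i := by
    rw [← List.ofFn_seqShift_cyclicSeq _ hne, hcyc, List.ofFn_congr List.length_ofFn]
    simp
  have hlyn : IsLyndon (List.ofFn fun i : Fin p => g i) := by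
    refine ⟨hne, fun j hj0 hj => ?_⟩
    rw [List.length_ofFn] at hj
    rw [hrot]
    refine lt_of_le_of_ne (α := List α) ?_ fun heq => ?_
    · have := hmin ((j + k) % p) (Finset.mem_range.mpr (Nat.mod_lt _ hppos))
      rwa [hper.iterate_mod_apply, iterate_add_apply] at this
    · have hfix : g = seqShift^[j] g :=
        eq_of_isPeriodicPt_seqShift hppos hgper (hgper.apply_iterate j) fun i hi =>
          congrFun (List.ofFn_injective heq) ⟨i, hi⟩
      have hmp : minimalPeriod seqShift g = p :=
        minimalPeriod_apply_iterate (mk_mem_periodicPts hn hf) k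
      exact not_isPeriodicPt_of_pos_of_lt_minimalPeriod hj0.ne' (hmp ▸ hj) hfix.symm
  refine ⟨_, hlyn, (p - k) % p, ?_, ?_, ?_⟩
  · rw [List.length_ofFn]; exact hf.minimalPeriod_dvd
  · rw [List.length_ofFn]; exact Nat.mod_lt _ hppos
  · rw [hcyc, hgper.iterate_mod_apply, hg, ← iterate_add_apply, Nat.sub_add_cancel hk.le]
    exact hper

end PeriodicWords

section CycleSums

open Function

variable {α R : Type*} [CommRing R]

theorem prod_range_seqShift_iterate (B : α → α → R) {f : ℕ → α} {n : ℕ}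
    (hf : IsPeriodicPt seqShift n f) (k : ℕ) :
    ∏ i ∈ Finset.range n, B (seqShift^[k] f i) (seqShift^[k] f (i + 1)) =
      ∏ i ∈ Finset.range n, B (f i) (f (i + 1)) := by
  induction k with
  | zero => rfl
  | succ k ih =>
    rw [← ih]
    have hper : seqShift^[k] f n = seqShift^[k] f 0 ∧
        seqShift^[k] f (n + 1) = seqShift^[k] f 1 := by
      have h := hf.apply_iterate k
      constructor
      · simpa [seqShift_iterate_apply] using congrFun h 0
      · simpa [seqShift_iterate_apply, add_comm, add_left_comm] using congrFun h 1
    rw [iterate_succ_apply']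
    cases n with
    | zero => rfl
    | succ n =>
      rw [Finset.prod_range_succ, Finset.prod_range_succ' _ n, zero_add, ← hper.1, ← hper.2]
      rfl

theorem prod_range_mul_of_isPeriodicPt (B : α → α → R) {f : ℕ → α} {n : ℕ}
    (hf : IsPeriodicPt seqShift n f) (m : ℕ) :
    ∏ i ∈ Finset.range (n * m), B (f i) (f (i + 1)) =
      (∏ i ∈ Finset.range n, B (f i) (f (i + 1))) ^ m := by
  induction m with
  | zero => simp
  | succ m ih =>
    rw [mul_add, mul_one, Finset.prod_range_add, ih, pow_succ]
    congr 1
    refine Finset.prod_congr rfl fun i _ => ?_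
    have h (i : ℕ) : f (n * m + i) = f i := by
      simpa [seqShift_iterate_apply, add_comm] using congrFun (hf.mul_const m) i
    rw [add_assoc, h, h]

end CycleSums

theorem cycleWeight_eq_prod_range {r : ℕ} (c : List (Fin r)) (hc : c ≠ []) :
    cycleWeight c = ∏ i ∈ Finset.range c.length,
      MvPowerSeries.X (c.cyclicSeq hc i, c.cyclicSeq hc (i + 1)) := by
  have h : (c.zip (c.rotate 1)).map (fun e => (MvPowerSeries.X e : MvPowerSeries _ ℚ)) =
      List.ofFn fun i : Fin c.length =>
        MvPowerSeries.X (c.cyclicSeq hc i, c.cyclicSeq hc (i + 1)) := by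
    refine List.ext_getElem (by simp) fun i h₁ h₂ => ?_
    have hi : i < c.length := by simpa using h₂
    simp [List.getElem_rotate, List.cyclicSeq, Nat.mod_eq_of_lt hi]
  rw [cycleWeight, h, List.prod_ofFn, Finset.prod_range]

theorem Matrix.pow_succ_apply_eq_sum {n R : Type*} [Fintype n] [DecidableEq n] [CommRing R]
    (B : Matrix n n R) (m : ℕ) (i j : n) :
    (B ^ (m + 1)) i j = ∑ v : Fin m → n,
      ∏ k : Fin (m + 1),
        B (Fin.cons (α := fun _ => n) i v k) (Fin.snoc (α := fun _ => n) v j k) := by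
  induction m generalizing i with
  | zero => simp [Fin.snoc]
  | succ m ih =>
    rw [pow_succ', Matrix.mul_apply, ← (Fin.consEquiv fun _ : Fin (m + 1) => n).sum_comp,
      Fintype.sum_prod_type]
    refine Finset.sum_congr rfl fun l _ => ?_
    rw [ih, Finset.mul_sum]
    refine Finset.sum_congr rfl fun v _ => ?_
    rw [Fin.prod_univ_succ (n := m + 1)]
    simp [Fin.consEquiv, ← Fin.cons_snoc_eq_snoc_cons]

theorem Matrix.trace_pow_succ_eq_sum {n R : Type*} [Fintype n] [DecidableEq n] [CommRing R]
    (B : Matrix n n R) (m : ℕ) :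
    (B ^ (m + 1)).trace = ∑ w : Fin (m + 1) → n, ∏ k, B (w k) (w (finRotate _ k)) := by
  rw [← (Fin.consEquiv fun _ : Fin (m + 1) => n).sum_comp, Fintype.sum_prod_type]
  refine Finset.sum_congr rfl fun i _ => ?_
  rw [Matrix.diag_apply, Matrix.pow_succ_apply_eq_sum]
  simp only [Fin.snoc_eq_cons_rotate]
  rfl

/-- Every word of length `n` is a rotation of a power of a unique Lyndon word `c`, in `c.length`
ways, so a rotation-invariant sum over words reduces to a sum over Lyndon words. -/
theorem sum_words_eq_sum_isLyndon {α R : Type*} [LinearOrder α] [Fintype α] [CommRing R]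
    (F : (ℕ → α) → R) {n : ℕ} (hn : 0 < n) (S : Finset {w : List α // IsLyndon w})
    (hS : ∀ c : {w : List α // IsLyndon w}, c.1.length ≤ n → c ∈ S)
    (G : (Fin n → α) → R)
    (hG : ∀ f, Function.IsPeriodicPt seqShift n f → G (fun i => f i) = F f)
    (hF : ∀ f, Function.IsPeriodicPt seqShift n f → ∀ k, F (seqShift^[k] f) = F f) :
    ∑ w, G w = ∑ c ∈ S with c.1.length ∣ n, (c.1.length : R) * F (c.1.cyclicSeq c.2.1) := by
  have hper {c : {w : List α // IsLyndon w}} (hc : c.1.length ∣ n) :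
      Function.IsPeriodicPt seqShift n (c.1.cyclicSeq c.2.1) :=
    (c.1.isPeriodicPt_cyclicSeq c.2.1).trans_dvd hc
  have hsum : ∑ c ∈ S with c.1.length ∣ n, (c.1.length : R) * F (c.1.cyclicSeq c.2.1) =
      ∑ x ∈ (S.filter fun c => c.1.length ∣ n).sigma fun c => Finset.range c.1.length,
        F (x.1.1.cyclicSeq x.1.2.1) := by
    rw [Finset.sum_sigma]
    refine Finset.sum_congr rfl fun c _ => ?_
    refine Eq.trans ?_ (Finset.sum_const (F (c.1.cyclicSeq c.2.1))).symm
    rw [Finset.card_range, nsmul_eq_mul]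
  rw [hsum]
  symm
  refine Finset.sum_bij (fun x _ i => seqShift^[x.2] (x.1.1.cyclicSeq x.1.2.1) i)
    (fun _ _ => Finset.mem_univ _) ?_ ?_ ?_
  · rintro ⟨c, k⟩ hx ⟨c', k'⟩ hx' heq
    simp only [Finset.mem_sigma, Finset.mem_filter, Finset.mem_range] at hx hx'
    have hseq := eq_of_isPeriodicPt_seqShift hn ((hper hx.1.2).apply_iterate k)
      ((hper hx'.1.2).apply_iterate k') fun i hi => congrFun heq ⟨i, hi⟩
    obtain ⟨hc, rfl⟩ := c.2.eq_of_seqShift_eq c'.2 hx.2 hx'.2 hseq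
    obtain rfl := Subtype.ext hc
    rfl
  · intro w _
    have hw : Function.IsPeriodicPt seqShift n fun i => w ⟨i % n, Nat.mod_lt _ hn⟩ := by
      funext i
      simp [seqShift_iterate_apply]
    obtain ⟨c, hc, k, hdvd, hk, hseq⟩ := exists_isLyndon_seqShift_eq hn hw
    refine ⟨⟨⟨c, hc⟩, k⟩, ?_, ?_⟩
    · simpa [hdvd, hk] using hS ⟨c, hc⟩ (Nat.le_of_dvd hn hdvd)
    · funext i
      simp only [hseq]
      congr 1
      exact Fin.ext (Nat.mod_eq_of_lt i.2)
  · rintro ⟨c, k⟩ hx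
    simp only [Finset.mem_sigma, Finset.mem_filter, Finset.mem_range] at hx
    rw [hG _ ((hper hx.1.2).apply_iterate k), hF _ (hper hx.1.2)]

/-- The generic matrix of commuting formal variables. -/
noncomputable def genericMatrix (r : ℕ) :
    Matrix (Fin r) (Fin r) (MvPowerSeries (Fin r × Fin r) ℚ) :=
  fun i j => X (i, j)

theorem isPure_genericMatrix (r : ℕ) (i j : Fin r) : (genericMatrix r i j).IsPure 1 :=
  isPure_X (i, j)

theorem trace_genericMatrix_pow {r n : ℕ} (hn : 0 < n)
    (S : Finset {w : List (Fin r) // IsLyndon w})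
    (hS : ∀ c : {w : List (Fin r) // IsLyndon w}, c.1.length ≤ n → c ∈ S) :
    (genericMatrix r ^ n).trace =
      ∑ c ∈ S with c.1.length ∣ n, (c.1.length : MvPowerSeries (Fin r × Fin r) ℚ) *
        cycleWeight c.1 ^ (n / c.1.length) := by
  obtain ⟨m, rfl⟩ := Nat.exists_eq_succ_of_ne_zero hn.ne'
  rw [Matrix.trace_pow_succ_eq_sum, sum_words_eq_sum_isLyndon
    (fun f => ∏ i ∈ Finset.range (m + 1), genericMatrix r (f i) (f (i + 1))) hn S hS]
  · refine Finset.sum_congr rfl fun c hc => ?_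
    rw [Finset.mem_filter] at hc
    rw [cycleWeight_eq_prod_range c.1 c.2.1]
    congr 1
    have h := prod_range_mul_of_isPeriodicPt (genericMatrix r)
      (c.1.isPeriodicPt_cyclicSeq c.2.1) ((m + 1) / c.1.length)
    rwa [Nat.mul_div_cancel' hc.2] at h
  · intro f hf
    rw [Finset.prod_range]
    refine Finset.prod_congr rfl fun i _ => ?_
    congr 1
    rw [finRotate_apply]
    change f (i + 1 : Fin (m + 1)) = f (i + 1)
    rw [Fin.val_add_one]
    split_ifs with h
    · subst h
      simpa [seqShift_iterate_apply] using (congrFun hf 0).symm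
    · rfl
  · exact fun f hf k => prod_range_seqShift_iterate _ hf k

theorem isPure_cycleWeight {r : ℕ} (c : List (Fin r)) : (cycleWeight c).IsPure c.length := by
  simpa [cycleWeight] using
    isPure_list_prod_map (c.zip (c.rotate 1)) (isPure_X (σ := Fin r × Fin r))

theorem constantCoeff_cycleWeight {r : ℕ} {c : List (Fin r)} (hc : c ≠ []) :
    constantCoeff (cycleWeight c) = 0 := by
  rw [← coeff_zero_eq_constantCoeff_apply]
  exact (isPure_cycleWeight c).coeff_eq_zero (by simpa [eq_comm] using hc)

theorem constantCoeff_det_one_sub_genericMatrix (r : ℕ) :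
    constantCoeff (1 - genericMatrix r).det = 1 := by
  rw [RingHom.map_det, map_sub, map_one]
  have : (constantCoeff (R := ℚ)).mapMatrix (genericMatrix r) = 0 := by
    ext i j
    simp [genericMatrix]
  rw [this, sub_zero, Matrix.det_one]

theorem euler_det_one_sub_genericMatrix (r : ℕ) :
    euler (1 - genericMatrix r).det =
      (1 - genericMatrix r).det * (r - (1 - genericMatrix r)⁻¹.trace) := by
  set A := 1 - genericMatrix r with hA
  have hmap : A.map euler = A - 1 := by
    ext1 i j
    have hX : euler (genericMatrix r i j) = genericMatrix r i j := by
      simpa using euler_eq_of_isPure (isPure_genericMatrix r i j)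
    have h1 : euler ((1 : Matrix (Fin r) (Fin r) (MvPowerSeries (Fin r × Fin r) ℚ)) i j) = 0 := by
      rw [Matrix.one_apply]
      split_ifs <;> simp
    simp [hA, hX, h1]
  have hunit : IsUnit A.det := by
    rw [isUnit_iff_constantCoeff, constantCoeff_det_one_sub_genericMatrix]
    exact isUnit_one
  have hadj : A.adjugate = A.det • A⁻¹ := by
    rw [Matrix.inv_def, smul_smul, Ring.mul_inverse_cancel _ hunit, one_smul]
  rw [Derivation.map_det, hmap, hadj, Matrix.smul_mul, Matrix.trace_smul, mul_sub,
    Matrix.nonsing_inv_mul _ hunit, mul_one, Matrix.trace_sub, Matrix.trace_one, Fintype.card_fin,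
    smul_eq_mul]

theorem euler_one_sub_cycleWeight {r : ℕ} {c : List (Fin r)} (hc : c ≠ []) :
    euler (1 - cycleWeight c) =
      (1 - cycleWeight c) * ((c.length : MvPowerSeries (Fin r × Fin r) ℚ) * (1 - (1 - cycleWeight c)⁻¹)) := by
  have h := MvPowerSeries.mul_inv_cancel (1 - cycleWeight c)
    (by simp [constantCoeff_cycleWeight hc])
  rw [map_sub, Derivation.map_one_eq_zero, euler_eq_of_isPure (isPure_cycleWeight c)]
  linear_combination (c.length : MvPowerSeries (Fin r × Fin r) ℚ) * h

theorem coeff_natCast_mul {σ : Type*} (n : ℕ) (f : MvPowerSeries σ ℚ) (d : σ →₀ ℕ) :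
    coeff d ((n : MvPowerSeries σ ℚ) * f) = n * coeff d f := by
  rw [← nsmul_eq_mul, map_nsmul, nsmul_eq_mul]

theorem coeff_logDeriv_eq_zero {r n : ℕ} {S : Finset {w : List (Fin r) // IsLyndon w}}
    (hS : ∀ c : {w : List (Fin r) // IsLyndon w}, c.1.length ≤ n → c ∈ S)
    (d : Fin r × Fin r →₀ ℕ) (hd : d.degree ≤ n) :
    coeff d (∑ c ∈ S, (c.1.length : MvPowerSeries (Fin r × Fin r) ℚ) *
      (1 - (1 - cycleWeight c.1)⁻¹) -
        ((r : MvPowerSeries (Fin r × Fin r) ℚ) - (1 - genericMatrix r)⁻¹.trace)) = 0 := by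
  have hunit : IsUnit (1 - genericMatrix r).det := by
    rw [isUnit_iff_constantCoeff, constantCoeff_det_one_sub_genericMatrix]
    exact isUnit_one
  have htr : coeff d (1 - genericMatrix r)⁻¹.trace =
      coeff d (genericMatrix r ^ d.degree).trace := by
    simp only [Matrix.trace, map_sum, Matrix.diag_apply]
    refine Finset.sum_congr rfl fun i _ => ?_
    rw [coeff_right_inverse_one_sub one_pos (isPure_genericMatrix r)
      (Matrix.mul_nonsing_inv _ hunit), if_pos (one_dvd _), Nat.div_one]
  have hinv (c : {w : List (Fin r) // IsLyndon w}) :=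
    coeff_inv_one_sub (List.length_pos_iff.mpr c.2.1) (isPure_cycleWeight c.1) d
  rcases Nat.eq_zero_or_pos d.degree with h0 | hpos
  · have hsum : ∀ c ∈ S, coeff d ((c.1.length : MvPowerSeries (Fin r × Fin r) ℚ) *
        (1 - (1 - cycleWeight c.1)⁻¹)) = 0 := fun c _ => by
      rw [coeff_natCast_mul, map_sub, hinv, h0]
      simp
    rw [map_sub, map_sub, map_sum, Finset.sum_eq_zero hsum, htr, h0]
    simp
  · have hone : coeff d (1 : MvPowerSeries (Fin r × Fin r) ℚ) = 0 :=
      isPure_one.coeff_eq_zero hpos.ne'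
    have hr : coeff d (r : MvPowerSeries (Fin r × Fin r) ℚ) = 0 := by
      rw [← mul_one (r : MvPowerSeries (Fin r × Fin r) ℚ), coeff_natCast_mul, hone, mul_zero]
    rw [map_sub, map_sub, map_sum, htr, hr, trace_genericMatrix_pow hpos S
      fun c hc => hS c (hc.trans hd), map_sum, Finset.sum_filter, zero_sub, sub_neg_eq_add,
      ← Finset.sum_add_distrib]
    refine Finset.sum_eq_zero fun c _ => ?_
    rw [coeff_natCast_mul, map_sub, hone, hinv]
    split_ifs
    · rw [coeff_natCast_mul]; ring
    · simp

theorem coeff_prod_inv_one_sub_cycleWeight {r n : ℕ}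
    {S : Finset {w : List (Fin r) // IsLyndon w}}
    (hS : ∀ c : {w : List (Fin r) // IsLyndon w}, c.1.length ≤ n → c ∈ S)
    {d : Fin r × Fin r →₀ ℕ} (hd : d.degree ≤ n) :
    coeff d (∏ c ∈ S, (1 - cycleWeight c.1)⁻¹) = coeff d (1 - genericMatrix r).det⁻¹ := by
  set F := (1 - genericMatrix r).det with hF
  set P := ∏ c ∈ S, (1 - cycleWeight c.1) with hP
  have hF0 : constantCoeff F = 1 := constantCoeff_det_one_sub_genericMatrix r
  have hP0 : constantCoeff P = 1 := by
    rw [hP, map_prod]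
    exact Finset.prod_eq_one fun c _ => by simp [constantCoeff_cycleWeight c.2.1]
  have hFinv : F * F⁻¹ = 1 := MvPowerSeries.mul_inv_cancel _ (by simp [hF0])
  have hPinv : P * ∏ c ∈ S, (1 - cycleWeight c.1)⁻¹ = 1 := by
    rw [hP, ← Finset.prod_mul_distrib]
    exact Finset.prod_eq_one fun c _ =>
      MvPowerSeries.mul_inv_cancel _ (by simp [constantCoeff_cycleWeight c.2.1])
  have hDP : euler P = P * ∑ c ∈ S, (c.1.length : MvPowerSeries (Fin r × Fin r) ℚ) *
      (1 - (1 - cycleWeight c.1)⁻¹) :=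
    euler.map_prod_of_eq_mul S fun c _ => euler_one_sub_cycleWeight c.2.1
  have hDF := euler_det_one_sub_genericMatrix r
  have hDFinv := congrArg euler hFinv
  rw [Derivation.leibniz, Derivation.map_one_eq_zero, smul_eq_mul, smul_eq_mul, hDF, ← hF]
    at hDFinv
  have hD : euler (P * F⁻¹) = P * F⁻¹ * (∑ c ∈ S,
      (c.1.length : MvPowerSeries (Fin r × Fin r) ℚ) * (1 - (1 - cycleWeight c.1)⁻¹) -
        (r - (1 - genericMatrix r)⁻¹.trace)) := by
    rw [Derivation.leibniz, smul_eq_mul, smul_eq_mul, hDP]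
    linear_combination P * F⁻¹ * hDFinv - P * euler F⁻¹ * hFinv -
      P * F⁻¹ * (r - (1 - genericMatrix r)⁻¹.trace) * hFinv
  have hH0 : constantCoeff (P * F⁻¹) = 1 := by
    rw [map_mul, hP0, constantCoeff_inv, hF0]; simp
  rw [← coeff_mul_eq_of_coeff_eq_one (H := P * F⁻¹) (fun d hd =>
    coeff_eq_coeff_one_of_euler_eq hD (coeff_logDeriv_eq_zero hS) hH0 hd) hd]
  congr 1
  linear_combination F⁻¹ * hPinv

theorem finite_isLyndon_length_le (r n : ℕ) :
    {c : {w : List (Fin r) // IsLyndon w} | c.1.length ≤ n}.Finite :=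
  (List.finite_length_le (Fin r) n).preimage Subtype.val_injective.injOn

/-- For the generic `r × r` matrix `B` of commuting formal variables,
`1/det(I-B)` equals the product over all nonperiodic cycles `c` of the complete
digraph `K_r` of `1/(1 - β(c))`. -/
theorem det_inverse_eq_prod_nonperiodic_cycles (r : ℕ) :
    let B : Matrix (Fin r) (Fin r) (MvPowerSeries (Fin r × Fin r) ℚ) :=
      fun i j => MvPowerSeries.X (i, j)
    (Matrix.det (1 - B))⁻¹ =
      ∏' c : {w : List (Fin r) // IsLyndon w}, (1 - cycleWeight c.1)⁻¹ := by
  intro B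
  let : TopologicalSpace ℚ := ⊥
  have : DiscreteTopology ℚ := ⟨rfl⟩
  have : T2Space (MvPowerSeries (Fin r × Fin r) ℚ) :=
    inferInstanceAs (T2Space ((Fin r × Fin r →₀ ℕ) → ℚ))
  refine (HasProd.tprod_eq (L := .unconditional _) ?_).symm
  refine tendsto_pi_nhds.mpr fun d => ?_
  rw [nhds_discrete, Filter.tendsto_pure]
  refine Filter.eventually_atTop.mpr
    ⟨(finite_isLyndon_length_le r d.degree).toFinset, fun S hS => ?_⟩
  exact coeff_prod_inv_one_sub_cycleWeight
    (fun c hc => hS ((Set.Finite.mem_toFinset _).mpr hc)) le_rfl
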